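/- Let L ⊆ ℤ[x]^2 be the ℤ[x]-lattice generated by the single element (x^2 + 1 − x, x − x^2 − 1). Then the lattice σ-ideal I_L ⊆ K{y_1, y_2} is a σ-prime σ-ideal, and I_L = ⟨y_1^{x^2+1} y_2^x − y_1^x y_2^{x^2+1}, y_1^{x^3+1} − y_2^{x^3+1}⟩_r. -/

import Mathlib

open Polynomial

section SigmaRing

variable {R : Type*} [CommRing R]

/-- A σ-ideal: an ideal closed under the difference operator σ. -/
def IsSigmaIdeal (σ : R →+* R) (I : Ideal R) : Prop := ∀ a ∈ I, σ a ∈ I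

/-- A σ-ideal is well-mixed if `a * b ∈ I` implies `a * σ b ∈ I`. -/
def IsWellMixed (σ : R →+* R) (I : Ideal R) : Prop := ∀ a b : R, a * b ∈ I → a * σ b ∈ I

/-- `[F]`, the smallest σ-ideal containing `F`. -/
def sigmaIdealGen (σ : R →+* R) (F : Set R) : Ideal R :=
  sInf {I : Ideal R | F ⊆ I ∧ IsSigmaIdeal σ I}

/-- `⟨F⟩`, the smallest well-mixed σ-ideal containing `F` (well-mixed closure). -/
def wmClosure (σ : R →+* R) (F : Set R) : Ideal R :=
  sInf {I : Ideal R | F ⊆ I ∧ IsSigmaIdeal σ I ∧ IsWellMixed σ I}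

/-- `⟨F⟩_r`, the smallest radical well-mixed σ-ideal containing `F`. -/
def rwmClosure (σ : R →+* R) (F : Set R) : Ideal R :=
  sInf {I : Ideal R | F ⊆ I ∧ IsSigmaIdeal σ I ∧ IsWellMixed σ I ∧ I.IsRadical}

/-- Symbolic exponent: for `p = Σ c_i x^i ∈ ℕ[x]`, `a^p = Π (σ^i a)^(c_i)`. -/
noncomputable def sexp (σ : R →+* R) (a : R) (p : Polynomial ℕ) : R :=
  ∏ i ∈ Finset.range (p.natDegree + 1), ((⇑σ)^[i] a) ^ (p.coeff i)

/-- `I` is finitely generated as a radical well-mixed σ-ideal. -/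
def FinGenAsRWM (σ : R →+* R) (I : Ideal R) : Prop :=
  ∃ G : Set R, G.Finite ∧ G ⊆ (I : Set R) ∧ I = rwmClosure σ G

/-- σ-prime: a reflexive σ-ideal which is prime. -/
def IsSigmaPrime (σ : R →+* R) (I : Ideal R) : Prop :=
  IsSigmaIdeal σ I ∧ (∀ a : R, σ a ∈ I → a ∈ I) ∧ I.IsPrime

end SigmaRing

/-- The σ-polynomial ring `K{y_1,…,y_n}`: polynomials in variables `y_i^{x^j}`,
indexed by pairs `(i, j) ∈ Fin n × ℕ`. -/
abbrev DPoly (K : Type*) [Field K] (n : ℕ) := MvPolynomial (Fin n × ℕ) K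

section DPoly

variable {K : Type*} [Field K] {n : ℕ} (σK : K →+* K)

/-- The difference operator on `K{y_1,…,y_n}` extending `σK`, with `σ(y_i^{x^j}) = y_i^{x^{j+1}}`. -/
noncomputable def shift : DPoly K n →+* DPoly K n :=
  MvPolynomial.eval₂Hom ((MvPolynomial.C : K →+* DPoly K n).comp σK)
    (fun v => MvPolynomial.X (v.1, v.2 + 1))

/-- `y_i^p` for `p ∈ ℕ[x]`. -/
noncomputable def ypow (i : Fin n) (p : Polynomial ℕ) : DPoly K n :=
  sexp (shift σK) (MvPolynomial.X (i, 0)) p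

/-- `y_i^{x^a}`. -/
noncomputable def varPow (i : Fin n) (a : ℕ) : DPoly K n :=
  ypow σK i (Polynomial.X ^ a)

/-- The monomial `Y^f = Π y_i^{f_i}` for `f ∈ ℕ[x]^n`. -/
noncomputable def monom (f : Fin n → Polynomial ℕ) : DPoly K n :=
  ∏ i, ypow σK i (f i)

/-- A pure binomial `Y^f − Y^g`. -/
def IsPureBinomial (p : DPoly K n) : Prop :=
  ∃ f g : Fin n → Polynomial ℕ, p = monom σK f - monom σK g

/-- A binomial `a·Y^f + b·Y^g` with `a, b ∈ K^×`. -/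
def IsBinomial (p : DPoly K n) : Prop :=
  ∃ (a b : K) (f g : Fin n → Polynomial ℕ), a ≠ 0 ∧ b ≠ 0 ∧
    p = MvPolynomial.C a * monom σK f + MvPolynomial.C b * monom σK g

/-- A pure binomial σ-ideal: a σ-ideal generated by pure binomials. -/
def IsPureBinomialSigmaIdeal (I : Ideal (DPoly K n)) : Prop :=
  ∃ S : Set (DPoly K n), (∀ p ∈ S, IsPureBinomial σK p) ∧ I = sigmaIdealGen (shift σK) S

/-- Positive part of `f ∈ ℤ[x]`. -/
noncomputable def posPart (f : Polynomial ℤ) : Polynomial ℕ :=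
  f.sum fun i c => Polynomial.monomial i c.toNat

/-- Negative part of `f ∈ ℤ[x]`. -/
noncomputable def negPart (f : Polynomial ℤ) : Polynomial ℕ :=
  f.sum fun i c => Polynomial.monomial i (-c).toNat

/-- The lattice σ-ideal `I_L = [Y^{f_+} − Y^{f_−} : f ∈ L]` of a ℤ[x]-lattice `L ⊆ ℤ[x]^n`. -/
noncomputable def latticeIdeal (L : Submodule (Polynomial ℤ) (Fin n → Polynomial ℤ)) :
    Ideal (DPoly K n) :=
  sigmaIdealGen (shift σK)
    {p | ∃ f ∈ L, p = monom σK (fun i => posPart (f i)) - monom σK (fun i => negPart (f i))}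

end DPoly

/-- `𝔪`: the multiplicatively closed set generated by the variables `y_i^{x^j}`. -/
def mSet (K : Type*) [Field K] (n : ℕ) : Set (DPoly K n) :=
  (Submonoid.closure (Set.range fun v : Fin n × ℕ => (MvPolynomial.X v : DPoly K n)) : Set _)

/-- `I : 𝔪 = {p : M p ∈ I for some M ∈ 𝔪}`. -/
def colonM {K : Type*} [Field K] {n : ℕ} (I : Ideal (DPoly K n)) : Set (DPoly K n) :=
  {p | ∃ M ∈ mSet K n, M * p ∈ I}

section Tsec

variable {K : Type*} [Field K] {n t : ℕ} (σK : K →+* K)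

/-- The set `T^{a_1…a_t}_{j_1…j_t}` of monomials `Y^f` with `deg f_{j_i} < a_i`. -/
def Tset (j : Fin t → Fin n) (a : Fin t → ℕ) : Set (DPoly K n) :=
  {p | ∃ f : Fin n → Polynomial ℕ,
    (∀ i : Fin t, (f (j i)).degree < (a i : WithBot ℕ)) ∧ p = monom σK f}

/-- `I` is saturated with respect to `{y_{j_1}^{x^{a_1}},…,y_{j_t}^{x^{a_t}}}`. -/
def SaturatedWrt (j : Fin t → Fin n) (a : Fin t → ℕ) (I : Ideal (DPoly K n)) : Prop :=
  ∀ g M : DPoly K n, M ∈ Tset σK j a → M * g ∈ I → g ∈ I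

/-- `J : T = {g : M g ∈ J for some M ∈ T}`. -/
def colonT (j : Fin t → Fin n) (a : Fin t → ℕ) (J : Ideal (DPoly K n)) : Set (DPoly K n) :=
  {g | ∃ M ∈ Tset σK j a, M * g ∈ J}

/-- The `T`-saturated closure `N^{a_1…a_t}_{j_1…j_t}(I)`: the smallest saturated σ-ideal
containing `I`. -/
noncomputable def Nclosure (j : Fin t → Fin n) (a : Fin t → ℕ) (I : Ideal (DPoly K n)) :
    Ideal (DPoly K n) :=
  sInf {J : Ideal (DPoly K n) | I ≤ J ∧ IsSigmaIdeal (shift σK) J ∧ SaturatedWrt σK j a J}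

/-- The set of variables `{y_{j_1}^{x^{a_1}},…,y_{j_t}^{x^{a_t}}}`. -/
noncomputable def varSet (j : Fin t → Fin n) (a : Fin t → ℕ) : Set (DPoly K n) :=
  Set.range fun i => varPow σK (j i) (a i)

/-- `⟨I₀ ∪ {y_{j_1}^{x^{a_1}},…,y_{j_t}^{x^{a_t}}}⟩_r` is quasi-normal. -/
def QuasiNormal (j : Fin t → Fin n) (a : Fin t → ℕ) (I0 : Ideal (DPoly K n)) : Prop :=
  SaturatedWrt σK j a I0 ∧
  ∀ f g : Fin n → Polynomial ℕ, monom σK f - monom σK g ∈ I0 →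
    monom σK f ∈ sigmaIdealGen (shift σK) (varSet σK j a) →
    monom σK g ∈ sigmaIdealGen (shift σK) (varSet σK j a)

end Tsec

section Relations

variable {M : Type*} [AddCommGroup M]

/-- If `c (j + 2) - c (j + 1) + c j = 0` for all `j ≤ deg h`, then the `ℤ`-linear map `x ^ j ↦ c j`
kills `h * (x ^ 2 + 1 - x)`. -/
lemma sum_coeff_smul_eq_zero (c : ℕ → M) (h : ℤ[X])
    (hc : ∀ j ≤ h.natDegree, c (j + 2) + c j - c (j + 1) = 0) :
    ∑ j ∈ Finset.range ((h * (X ^ 2 + 1 - X)).natDegree + 1),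
      (h * (X ^ 2 + 1 - X)).coeff j • c j = 0 := by
  let ψ : ℤ[X] →ₗ[ℤ] M := Polynomial.lsum fun j => LinearMap.toSpanSingleton ℤ M (c j)
  have hψ (j : ℕ) (n : ℤ) : ψ (monomial j n) = n • c j := by
    simp [ψ, Polynomial.sum_monomial_index]
  have key : ψ (h * (X ^ 2 + 1 - X)) = 0 := by
    conv_lhs => rw [h.as_sum_range' _ (Nat.lt_succ_self _), Finset.sum_mul, map_sum]
    refine Finset.sum_eq_zero fun j hj => ?_
    have hm : monomial j (h.coeff j) * (X ^ 2 + 1 - X) =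
        monomial (j + 2) (h.coeff j) + monomial j (h.coeff j) - monomial (j + 1) (h.coeff j) := by
      rw [mul_sub, mul_add, mul_one, monomial_mul_X_pow, monomial_mul_X]
    rw [hm, map_sub, map_add, hψ, hψ, hψ, ← smul_add, ← smul_sub,
      hc j (Nat.lt_succ_iff.1 (Finset.mem_range.1 hj)), smul_zero]
  rw [← key]
  simp only [ψ, Polynomial.lsum_apply]
  rw [Polynomial.sum_over_range _ (by simp)]
  simp

end Relations

section FieldPoints

variable {F : Type*} [Field F]

lemma div_zpow_eq_div (x y : F) (n : ℤ) :
    (x / y) ^ n = x ^ n.toNat * y ^ (-n).toNat / (x ^ (-n).toNat * y ^ n.toNat) := by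
  rcases le_total 0 n with hn | hn
  · lift n to ℕ using hn
    simp [div_pow]
  · obtain ⟨m, rfl⟩ : ∃ m : ℕ, n = -m := ⟨(-n).toNat, by omega⟩
    simp [div_pow]

/-- The binomials of the lattice spanned by `(x ^ 2 + 1 - x, x - x ^ 2 - 1)` vanish at every pair of
sequences, constantly zero after their first zero, at which the shifts of the two binomials for the
multipliers `1` and `x + 1` vanish. -/
lemma prod_pow_toNat_eq (a b : ℕ → F) (ha : ∀ i, a i = 0 → a (i + 1) = 0)
    (hb : ∀ i, b i = 0 → b (i + 1) = 0)
    (h₂ : ∀ i, a (i + 2) * a i * b (i + 1) = a (i + 1) * (b (i + 2) * b i))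
    (h₃ : ∀ i, a (i + 3) * a i = b (i + 3) * b i)
    (h g : ℤ[X]) (hg : g = h * (X ^ 2 + 1 - X)) :
    (∏ j ∈ Finset.range (g.natDegree + 1), a j ^ (g.coeff j).toNat) *
      ∏ j ∈ Finset.range (g.natDegree + 1), b j ^ (-g.coeff j).toNat =
    (∏ j ∈ Finset.range (g.natDegree + 1), a j ^ (-g.coeff j).toNat) *
      ∏ j ∈ Finset.range (g.natDegree + 1), b j ^ (g.coeff j).toNat := by
  by_cases h0 : h = 0
  · simp [hg, h0]
  have hf : (X ^ 2 + 1 - X : ℤ[X]).natDegree = 2 := by compute_degree!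
  have hf0 : (X ^ 2 + 1 - X : ℤ[X]) ≠ 0 := by
    intro h'; simp [h'] at hf
  have hd : g.natDegree = h.natDegree + 2 := by
    rw [hg, natDegree_mul h0 hf0, hf]
  have hlc : g.coeff g.natDegree ≠ 0 := by
    rw [coeff_natDegree, leadingCoeff_ne_zero, hg]
    exact mul_ne_zero h0 hf0
  have hself : g.natDegree ∈ Finset.range (g.natDegree + 1) := Finset.self_mem_range_succ _
  have hmono (u : ℕ → F) (hu : ∀ i, u i = 0 → u (i + 1) = 0) (i j : ℕ) (hij : i ≤ j)
      (hi : u i = 0) : u j = 0 := Nat.le_induction hi (fun n _ => hu n) j hij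
  by_cases hz : a g.natDegree = 0 ∧ b g.natDegree = 0
  · have hprod (u : ℕ → F) (hu : u g.natDegree = 0) (e : ℕ → ℕ) (he : e g.natDegree ≠ 0) :
        ∏ j ∈ Finset.range (g.natDegree + 1), u j ^ e j = 0 :=
      Finset.prod_eq_zero hself (by rw [hu, zero_pow he])
    rcases lt_or_gt_of_ne hlc with hn | hn
    · rw [hprod b hz.2 (fun j => (-g.coeff j).toNat) (by simpa using hn),
        hprod a hz.1 (fun j => (-g.coeff j).toNat) (by simpa using hn), mul_zero, zero_mul]
    · rw [hprod a hz.1 (fun j => (g.coeff j).toNat) (by simpa using hn),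
        hprod b hz.2 (fun j => (g.coeff j).toNat) (by simpa using hn), mul_zero, zero_mul]
  rcases Nat.eq_zero_or_pos h.natDegree with hh | hh
  · obtain ⟨k, rfl⟩ : ∃ k, h = C k := ⟨_, eq_C_of_natDegree_eq_zero hh⟩
    have c0 : g.coeff 0 = k := by simp [hg]
    have c1 : g.coeff 1 = -k := by simp [hg, coeff_one, coeff_X]
    have c2 : g.coeff 2 = k := by simp [hg, coeff_one, coeff_X]
    have h2 := h₂ 0
    simp only [hd, hh, Finset.prod_range_succ, Finset.prod_range_zero, c0, c1, c2, neg_neg, one_mul]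
    rcases le_total 0 k with hk | hk
    · have : (-k).toNat = 0 := by omega
      simp only [this, pow_zero, one_mul, mul_one, ← mul_pow]
      congr 1
      linear_combination h2
    · have : k.toNat = 0 := by omega
      simp only [this, pow_zero, one_mul, mul_one, ← mul_pow]
      congr 1
      linear_combination -h2
  have h3 := h₃ (h.natDegree - 1)
  have hsub : h.natDegree - 1 + 3 = g.natDegree := by omega
  rw [hsub] at h3
  have hle : h.natDegree - 1 ≤ g.natDegree := by omega
  have hab : a g.natDegree ≠ 0 ∧ b g.natDegree ≠ 0 := by
    rw [not_and_or] at hz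
    rcases hz with hz | hz
    · have : a (h.natDegree - 1) ≠ 0 := fun h' => hz (hmono a ha _ _ hle h')
      exact ⟨hz, left_ne_zero_of_mul (h3 ▸ mul_ne_zero hz this)⟩
    · have : b (h.natDegree - 1) ≠ 0 := fun h' => hz (hmono b hb _ _ hle h')
      exact ⟨left_ne_zero_of_mul (h3.symm ▸ mul_ne_zero hz this), hz⟩
  have ha' (j : ℕ) (hj : j ≤ g.natDegree) : a j ≠ 0 := fun h' => hab.1 (hmono a ha _ _ hj h')
  have hb' (j : ℕ) (hj : j ≤ g.natDegree) : b j ≠ 0 := fun h' => hab.2 (hmono b hb _ _ hj h')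
  classical
  let c : ℕ → Fˣ := fun j => if hj : a j / b j ≠ 0 then Units.mk0 _ hj else 1
  have hc (j : ℕ) (hj : j ≤ g.natDegree) : (c j : F) = a j / b j := by
    simp only [c]
    rw [dif_pos (div_ne_zero (ha' j hj) (hb' j hj)), Units.val_mk0]
  have hrel : ∏ j ∈ Finset.range (g.natDegree + 1), c j ^ g.coeff j = 1 := by
    have := sum_coeff_smul_eq_zero (fun j => Additive.ofMul (c j)) h fun j hj => by
      rw [← ofMul_mul, ← ofMul_div, ofMul_eq_zero, div_eq_one, Units.ext_iff, Units.val_mul,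
        hc _ (by omega), hc _ (by omega), hc _ (by omega)]
      have := hb' (j + 2) (by omega)
      have := hb' (j + 1) (by omega)
      have := hb' j (by omega)
      field_simp
      linear_combination h₂ j
    rw [← hg] at this
    simpa only [← ofMul_zpow, ← ofMul_prod, ofMul_eq_zero] using this
  have hrel' := congrArg (Units.val : Fˣ → F) hrel
  rw [Units.coe_prod, Units.val_one] at hrel'
  rw [Finset.prod_congr rfl fun j hj => by
    rw [Units.val_zpow_eq_zpow_val, hc j (Nat.lt_succ_iff.1 (Finset.mem_range.1 hj)),
      div_zpow_eq_div],
    Finset.prod_div_distrib, Finset.prod_mul_distrib, Finset.prod_mul_distrib, div_eq_one_iff_eq]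
    at hrel'
  · exact hrel'
  · refine mul_ne_zero ?_ ?_ <;>
      refine Finset.prod_ne_zero_iff.2 fun j hj => pow_ne_zero _ ?_
    · exact ha' j (Nat.lt_succ_iff.1 (Finset.mem_range.1 hj))
    · exact hb' j (Nat.lt_succ_iff.1 (Finset.mem_range.1 hj))

end FieldPoints

section WellMixed

variable {R : Type*} [CommRing R] {σ : R →+* R}

lemma subset_sigmaIdealGen (F : Set R) : F ⊆ sigmaIdealGen σ F := by
  intro a ha
  simp only [sigmaIdealGen, SetLike.mem_coe, Submodule.mem_sInf]
  exact fun I hI => hI.1 ha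

lemma sigmaIdealGen_le {F : Set R} {I : Ideal R} (hF : F ⊆ I) (hI : IsSigmaIdeal σ I) :
    sigmaIdealGen σ F ≤ I :=
  sInf_le ⟨hF, hI⟩

lemma rwmClosure_le_of_isSigmaPrime {F : Set R} {I : Ideal R} (hF : F ⊆ I)
    (hI : IsSigmaPrime σ I) : rwmClosure σ F ≤ I := by
  refine sInf_le ⟨hF, hI.1, fun a b hab => ?_, hI.2.2.isRadical⟩
  rcases hI.2.2.mem_or_mem hab with h | h
  · exact I.mul_mem_right _ h
  · exact I.mul_mem_left _ (hI.1 b h)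

/-- Minimal primes of a radical well-mixed ideal are closed under `σ`. -/
lemma isSigmaIdeal_of_mem_minimalPrimes {I p : Ideal R} (hwm : IsWellMixed σ I)
    (hrad : I.IsRadical) (hp : p ∈ I.minimalPrimes) : IsSigmaIdeal σ p := by
  intro a ha
  have := hp.1.1
  obtain ⟨x, hxI, hx⟩ : ∃ x ∈ I, x ∈ p.primeCompl ⊔ Submonoid.powers a := by
    by_contra! hdis
    obtain ⟨q, hq, hIq, hqS⟩ := Ideal.exists_le_prime_disjoint I _ (Set.disjoint_left.2 hdis)
    have hqp : q ≤ p := fun y hy => by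
      by_contra hyp
      exact Set.disjoint_left.1 hqS hy (Submonoid.mem_sup_left hyp)
    exact Set.disjoint_left.1 hqS (hp.2 ⟨hq, hIq⟩ hqp ha)
      (Submonoid.mem_sup_right (Submonoid.mem_powers a))
  obtain ⟨s, hs, -, ⟨n, rfl⟩, rfl⟩ := Submonoid.mem_sup.1 hx
  have hsa : s * a ∈ I := by
    refine hrad ⟨n + 1, ?_⟩
    have : (s * a) ^ (n + 1) = s ^ n * a * (s * a ^ n) := by ring
    exact this ▸ I.mul_mem_left _ hxI
  exact (hp.1.1.mem_or_mem (hp.1.2 (hwm s a hsa))).resolve_left hs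

/-- A radical well-mixed σ-ideal is an intersection of prime σ-ideals. -/
lemma mem_rwmClosure_of_forall_prime {F : Set R} {r : R}
    (h : ∀ p : Ideal R, p.IsPrime → IsSigmaIdeal σ p → F ⊆ p → r ∈ p) :
    r ∈ rwmClosure σ F := by
  simp only [rwmClosure, Submodule.mem_sInf]
  rintro I ⟨hF, -, hwm, hrad⟩
  rw [← hrad.radical, ← Ideal.sInf_minimalPrimes, Submodule.mem_sInf]
  exact fun p hp => h p hp.1.1 (isSigmaIdeal_of_mem_minimalPrimes hwm hrad hp)
    (hF.trans hp.1.2)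

lemma isSigmaIdeal_rwmClosure (F : Set R) : IsSigmaIdeal σ (rwmClosure σ F) := by
  intro a ha
  simp only [rwmClosure, Submodule.mem_sInf] at ha ⊢
  exact fun I hI => hI.2.1 a (ha I hI)

end WellMixed

section Monomials

variable {K : Type*} [Field K] {n : ℕ} (σK : K →+* K)

@[simp]
lemma shift_X (v : Fin n × ℕ) :
    shift σK (MvPolynomial.X v) = MvPolynomial.X (v.1, v.2 + 1) := by
  simp [shift]

@[simp]
lemma shift_C (k : K) :
    shift σK (MvPolynomial.C k : DPoly K n) = MvPolynomial.C (σK k) := by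
  simp [shift]

lemma shift_iterate_X (i : Fin n) (j : ℕ) :
    (shift σK)^[j] (MvPolynomial.X (i, 0)) = MvPolynomial.X (i, j) := by
  induction j with
  | zero => rfl
  | succ j ih => rw [Function.iterate_succ_apply', ih, shift_X]

lemma ypow_eq_prod (i : Fin n) (p : ℕ[X]) {N : ℕ} (hN : p.natDegree < N) :
    ypow σK i p = ∏ j ∈ Finset.range N, MvPolynomial.X (i, j) ^ p.coeff j := by
  simp only [ypow, sexp, shift_iterate_X]
  refine Finset.prod_subset (by simpa using hN) fun j _ hj => ?_
  rw [coeff_eq_zero_of_natDegree_lt (by simpa using hj), pow_zero]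

lemma ypow_add (i : Fin n) (p q : ℕ[X]) : ypow σK i (p + q) = ypow σK i p * ypow σK i q := by
  have hN : (p + q).natDegree < p.natDegree + q.natDegree + 1 :=
    (natDegree_add_le p q).trans_lt (by omega)
  rw [ypow_eq_prod σK i _ hN, ypow_eq_prod σK i p (N := p.natDegree + q.natDegree + 1) (by omega),
    ypow_eq_prod σK i q (N := p.natDegree + q.natDegree + 1) (by omega),
    ← Finset.prod_mul_distrib]
  simp [pow_add]

lemma ypow_X_pow (i : Fin n) (j : ℕ) : ypow σK i (X ^ j) = MvPolynomial.X (i, j) := by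
  rw [ypow_eq_prod σK i _ (N := j + 1) (by simp),
    Finset.prod_eq_single j]
  · simp
  · intro k _ hk
    simp [coeff_X_pow, hk]
  · simp

lemma ypow_X (i : Fin n) : ypow σK i X = MvPolynomial.X (i, 1) := by
  simpa using ypow_X_pow σK i 1

lemma ypow_one (i : Fin n) : ypow σK i 1 = MvPolynomial.X (i, 0) := by
  simpa using ypow_X_pow σK i 0

lemma coeff_posPart (f : ℤ[X]) (j : ℕ) : (posPart f).coeff j = (f.coeff j).toNat := by
  simp only [_root_.posPart, Polynomial.sum, finsetSum_coeff, coeff_monomial]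
  simp +contextual

lemma coeff_negPart (f : ℤ[X]) (j : ℕ) : (negPart f).coeff j = (-f.coeff j).toNat := by
  simp only [_root_.negPart, Polynomial.sum, finsetSum_coeff, coeff_monomial]
  simp +contextual

lemma natDegree_posPart_le (f : ℤ[X]) : (posPart f).natDegree ≤ f.natDegree :=
  natDegree_le_iff_coeff_eq_zero.2 fun j hj => by
    rw [coeff_posPart, coeff_eq_zero_of_natDegree_lt hj, Int.toNat_zero]

lemma natDegree_negPart_le (f : ℤ[X]) : (negPart f).natDegree ≤ f.natDegree :=
  natDegree_le_iff_coeff_eq_zero.2 fun j hj => by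
    rw [coeff_negPart, coeff_eq_zero_of_natDegree_lt hj, neg_zero, Int.toNat_zero]

lemma posPart_neg_eq_negPart (f : ℤ[X]) : posPart (-f) = negPart f := by
  ext j; simp [coeff_posPart, coeff_negPart]

lemma negPart_neg_eq_posPart (f : ℤ[X]) : negPart (-f) = posPart f := by
  ext j; simp [coeff_posPart, coeff_negPart]

/-- The exponent of `y_i` in the monomial with exponent vector `s`, as a polynomial. -/
noncomputable def exponentPoly (i : Fin n) : (Fin n × ℕ →₀ ℕ) →+ ℕ[X] where
  toFun s := ⟨⟨s.curry i⟩⟩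
  map_zero' := by ext; simp [coeff]
  map_add' s t := by ext; simp [coeff]

@[simp]
lemma coeff_exponentPoly (i : Fin n) (s : Fin n × ℕ →₀ ℕ) (j : ℕ) :
    (exponentPoly i s).coeff j = s (i, j) := rfl

lemma exponentPoly_single (i : Fin n) (v : Fin n × ℕ) :
    exponentPoly i (Finsupp.single v 1) = if v.1 = i then X ^ v.2 else 0 := by
  ext j
  obtain ⟨k, l⟩ := v
  by_cases h : k = i <;> simp [Finsupp.single_apply, coeff_X_pow, h, eq_comm (a := l)]

lemma monom_exponentPoly (s : Fin n × ℕ →₀ ℕ) :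
    monom σK (fun i => exponentPoly i s) = MvPolynomial.monomial s 1 := by
  obtain ⟨N, hN⟩ : ∃ N, ∀ v ∈ s.support, v.2 < N :=
    ⟨s.support.sup Prod.snd + 1, fun v hv => Nat.lt_succ_of_le (Finset.le_sup (f := Prod.snd) hv)⟩
  have hdeg (i : Fin n) : (exponentPoly i s).natDegree < N + 1 := by
    refine Nat.lt_succ_of_le (natDegree_le_iff_coeff_eq_zero.2 fun j hj => ?_)
    by_contra h
    exact absurd (hN (i, j) (by simpa using h)) (by simpa using hj.le)
  have hsupp : s.support ⊆ Finset.univ ×ˢ Finset.range (N + 1) := fun v hv => by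
    simpa using (hN v hv).le
  rw [MvPolynomial.monomial_eq, Finsupp.prod_of_support_subset _ hsupp _ (by simp),
    Finset.prod_product]
  simp only [monom, map_one, one_mul]
  refine Finset.prod_congr rfl fun i _ => ?_
  rw [ypow_eq_prod σK i _ (hdeg i)]
  rfl

end Monomials

section Toric

/-- The `ℚ`-vector space `ℚ[x] × ℚ[x] / (x ^ 2 + 1 - x)`, in which `ℤ[x]^2` modulo the lattice
spanned by `(x ^ 2 + 1 - x, x - x ^ 2 - 1)` embeds by `(u, v) ↦ (u + v, u)`. -/
abbrev GradeGroup : Type := ℚ[X] × AdjoinRoot (X ^ 2 + 1 - X : ℚ[X])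

/-- The degree in `GradeGroup` of an exponent vector. -/
noncomputable def toricDeg : (Fin 2 × ℕ →₀ ℕ) →+ GradeGroup :=
  AddMonoidHom.prod
    ((Polynomial.mapRingHom (Nat.castRingHom ℚ)).toAddMonoidHom.comp
      (exponentPoly 0 + exponentPoly 1))
    (((AdjoinRoot.mk _).comp (Polynomial.mapRingHom (Nat.castRingHom ℚ))).toAddMonoidHom.comp
      (exponentPoly 0))

lemma toricDeg_apply (s : Fin 2 × ℕ →₀ ℕ) :
    toricDeg s = ((exponentPoly 0 s).map (Nat.castRingHom ℚ) +
        (exponentPoly 1 s).map (Nat.castRingHom ℚ),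
      AdjoinRoot.mk _ ((exponentPoly 0 s).map (Nat.castRingHom ℚ))) := by
  simp [toricDeg]

/-- Multiplication by `x` on `GradeGroup`. -/
noncomputable def gradeShift : GradeGroup →+ GradeGroup :=
  AddMonoidHom.mulLeft (X, AdjoinRoot.root _)

lemma root_sq_add_one :
    AdjoinRoot.root (X ^ 2 + 1 - X : ℚ[X]) ^ 2 + 1 = AdjoinRoot.root (X ^ 2 + 1 - X : ℚ[X]) := by
  have := AdjoinRoot.mk_self (f := (X ^ 2 + 1 - X : ℚ[X]))
  rwa [map_sub, map_add, map_pow, map_one, AdjoinRoot.mk_X, sub_eq_zero] at this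

lemma gradeShift_injective : Function.Injective gradeShift := by
  rintro ⟨u, v⟩ ⟨u', v'⟩ h
  simp only [gradeShift, AddMonoidHom.coe_mulLeft, Prod.mk_mul_mk, Prod.mk.injEq] at h
  have hu := mul_left_cancel₀ X_ne_zero h.1
  have hr := root_sq_add_one
  set r := AdjoinRoot.root (X ^ 2 + 1 - X : ℚ[X])
  have hv : v = v' := by linear_combination (1 - r) * h.2 + (v - v') * hr
  rw [hu, hv]

lemma toricDeg_single_succ (v : Fin 2 × ℕ) :
    toricDeg (Finsupp.single (v.1, v.2 + 1) 1) = gradeShift (toricDeg (Finsupp.single v 1)) := by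
  obtain ⟨i, j⟩ := v
  fin_cases i <;>
    simp [toricDeg_apply, exponentPoly_single, gradeShift, pow_succ']

variable {K : Type*} [Field K] (σK : K →+* K)

/-- The monomial parametrization `y^s ↦ t^(deg s)` of the variety of the lattice ideal. -/
noncomputable def toricHom (K : Type*) [Field K] : DPoly K 2 →+* AddMonoidAlgebra K GradeGroup :=
  (MvPolynomial.aeval fun v => AddMonoidAlgebra.single (toricDeg (Finsupp.single v 1)) 1 :
    DPoly K 2 →ₐ[K] AddMonoidAlgebra K GradeGroup).toRingHom

lemma toricHom_X (v : Fin 2 × ℕ) :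
    toricHom K (MvPolynomial.X v) =
      AddMonoidAlgebra.single (toricDeg (Finsupp.single v 1)) 1 := by
  simp [toricHom]

lemma toricHom_C (k : K) : toricHom K (MvPolynomial.C k) = AddMonoidAlgebra.single 0 k := by
  simp [toricHom]

lemma toricHom_monomial (s : Fin 2 × ℕ →₀ ℕ) (k : K) :
    toricHom K (MvPolynomial.monomial s k) = AddMonoidAlgebra.single (toricDeg s) k := by
  induction s using Finsupp.induction_linear generalizing k with
  | zero => rw [map_zero, ← toricHom_C]; rfl
  | add s t hs ht =>
    rw [map_add, ← mul_one k, ← MvPolynomial.monomial_mul, map_mul, hs, ht,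
      AddMonoidAlgebra.single_mul_single]
  | single v n =>
    have hsingle : Finsupp.single v n = n • Finsupp.single v 1 := by simp
    rw [← MvPolynomial.C_mul_X_pow_eq_monomial, map_mul, map_pow, toricHom_X, toricHom_C,
      AddMonoidAlgebra.single_pow, AddMonoidAlgebra.single_mul_single, hsingle, map_nsmul]
    simp

/-- The endomorphism of the group algebra corresponding to the shift. -/
noncomputable def toricShift :
    AddMonoidAlgebra K GradeGroup →+* AddMonoidAlgebra K GradeGroup :=
  (AddMonoidAlgebra.mapDomainRingHom K gradeShift).comp (AddMonoidAlgebra.mapRingHom _ σK)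

lemma toricShift_injective : Function.Injective (toricShift σK) :=
  (AddMonoidAlgebra.mapDomain_injective gradeShift_injective).comp
    (AddMonoidAlgebra.map_injective _ σK.injective)

lemma toricHom_shift (p : DPoly K 2) :
    toricHom K (shift σK p) = toricShift σK (toricHom K p) := by
  suffices (toricHom K).comp (shift σK) = (toricShift σK).comp (toricHom K) from
    RingHom.congr_fun this p
  refine MvPolynomial.ringHom_ext (fun k => ?_) fun v => ?_
  · simp [toricHom_C, toricShift]
  · simp [toricHom_X, toricShift, toricDeg_single_succ]

/-- The kernel of the monomial parametrization is generated by binomials. -/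
lemma ker_toricHom_le {I : Ideal (DPoly K 2)}
    (hI : ∀ s t, toricDeg s = toricDeg t →
      MvPolynomial.monomial s 1 - MvPolynomial.monomial t 1 ∈ I) :
    RingHom.ker (toricHom K) ≤ I := by
  let lift : AddMonoidAlgebra K GradeGroup → DPoly K 2 := fun x =>
    x.coeff.sum fun g k => MvPolynomial.monomial (Function.invFun toricDeg g) k
  have hlift (p : DPoly K 2) : p - lift (toricHom K p) ∈ I := by
    induction p using MvPolynomial.induction_on' with
    | monomial s k =>
      have := I.mul_mem_left (MvPolynomial.C k)
        (hI s _ (Function.invFun_eq ⟨s, rfl⟩ : toricDeg _ = toricDeg s).symm)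
      simpa [lift, toricHom_monomial, mul_sub, MvPolynomial.C_mul_monomial] using this
    | add p q hp hq =>
      have hadd (x y) : lift (x + y) = lift x + lift y :=
        Finsupp.sum_add_index' (by simp) (by simp)
      rw [map_add, hadd, add_sub_add_comm]
      exact I.add_mem hp hq
  intro p hp
  have := hlift p
  rw [RingHom.mem_ker.1 hp] at this
  simpa [lift] using this

lemma isSigmaPrime_ker_toricHom : IsSigmaPrime (shift σK) (RingHom.ker (toricHom K)) := by
  refine ⟨fun p hp => ?_, fun p hp => ?_, RingHom.ker_isPrime _⟩
  · rw [RingHom.mem_ker] at hp ⊢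
    rw [toricHom_shift, hp, map_zero]
  · rw [RingHom.mem_ker] at hp ⊢
    rw [toricHom_shift] at hp
    exact toricShift_injective σK (hp.trans (map_zero _).symm)

end Toric

section LatticeIdeal

variable {K : Type*} [Field K] (σK : K →+* K)

lemma mem_span_lattice_iff (f : Fin 2 → ℤ[X]) :
    f ∈ Submodule.span ℤ[X] {![(X : ℤ[X]) ^ 2 + 1 - X, (X : ℤ[X]) - X ^ 2 - 1]} ↔
      (X ^ 2 + 1 - X : ℤ[X]) ∣ f 0 ∧ f 1 = -f 0 := by
  rw [Submodule.mem_span_singleton]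
  constructor
  · rintro ⟨h, rfl⟩
    refine ⟨⟨h, by simp [mul_comm]⟩, ?_⟩
    simp
    ring
  · rintro ⟨⟨h, hh⟩, h1⟩
    refine ⟨h, ?_⟩
    ext1 i
    fin_cases i
    · simp [hh, mul_comm]
    · simp [h1, hh]
      ring

/-- The two binomials generating the lattice ideal. -/
noncomputable abbrev latticeGenerators : Set (DPoly K 2) :=
  {ypow σK 0 (X ^ 2 + 1) * ypow σK 1 X - ypow σK 0 X * ypow σK 1 (X ^ 2 + 1),
    ypow σK 0 (X ^ 3 + 1) - ypow σK 1 (X ^ 3 + 1)}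

lemma latticeGenerators_subset_ker :
    latticeGenerators σK ⊆ RingHom.ker (toricHom K) := by
  have hr := root_sq_add_one
  rintro p (rfl | rfl) <;>
    simp only [SetLike.mem_coe, RingHom.mem_ker, ypow_add, ypow_X_pow, ypow_X, ypow_one,
      map_sub, map_mul, toricHom_X, AddMonoidAlgebra.single_mul_single, sub_eq_zero] <;>
    refine congrArg₂ AddMonoidAlgebra.single ?_ (by simp) <;>
    simp only [toricDeg_apply, exponentPoly_single] <;>
    simp
  · exact ⟨by ring, by linear_combination hr⟩
  · linear_combination (AdjoinRoot.root (X ^ 2 + 1 - X : ℚ[X]) + 1) * hr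

lemma lattice_binomial_mem_of_prime {p : Ideal (DPoly K 2)} [p.IsPrime]
    (hσ : IsSigmaIdeal (shift σK) p) (hp : latticeGenerators σK ⊆ p)
    {f : Fin 2 → ℤ[X]} (hdvd : (X ^ 2 + 1 - X : ℤ[X]) ∣ f 0) (hneg : f 1 = -f 0) :
    monom σK (fun i => _root_.posPart (f i)) - monom σK (fun i => _root_.negPart (f i)) ∈ p := by
  let θ : DPoly K 2 →+* FractionRing (DPoly K 2 ⧸ p) :=
    (algebraMap _ _).comp (Ideal.Quotient.mk p)
  have hθ (q : DPoly K 2) : θ q = 0 ↔ q ∈ p := by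
    simp only [θ, RingHom.comp_apply]
    rw [IsFractionRing.to_map_eq_zero_iff, Ideal.Quotient.eq_zero_iff_mem]
  have hzero (k : Fin 2) (i : ℕ) (hi : θ (MvPolynomial.X (k, i)) = 0) :
      θ (MvPolynomial.X (k, i + 1)) = 0 := by
    rw [hθ] at hi ⊢
    simpa using hσ _ hi
  have h₂ (i : ℕ) : (MvPolynomial.X (0, i + 2) * MvPolynomial.X (0, i) * MvPolynomial.X (1, i + 1) -
      MvPolynomial.X (0, i + 1) * (MvPolynomial.X (1, i + 2) * MvPolynomial.X (1, i)) :
        DPoly K 2) ∈ p := by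
    induction i with
    | zero => simpa [ypow_add, ypow_X_pow, ypow_X, ypow_one] using hp (Set.mem_insert _ _)
    | succ i ih => simpa using hσ _ ih
  have h₃ (i : ℕ) : (MvPolynomial.X (0, i + 3) * MvPolynomial.X (0, i) -
      MvPolynomial.X (1, i + 3) * MvPolynomial.X (1, i) : DPoly K 2) ∈ p := by
    induction i with
    | zero =>
      simpa [ypow_add, ypow_X_pow, ypow_X, ypow_one] using hp (Set.mem_insert_of_mem _ rfl)
    | succ i ih => simpa using hσ _ ih
  obtain ⟨h, hh⟩ := hdvd
  have key := prod_pow_toNat_eq (fun j => θ (MvPolynomial.X (0, j)))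
    (fun j => θ (MvPolynomial.X (1, j))) (hzero 0) (hzero 1)
    (fun i => by simpa [sub_eq_zero] using (hθ _).2 (h₂ i))
    (fun i => by simpa [sub_eq_zero] using (hθ _).2 (h₃ i)) h (f 0) (by rw [hh, mul_comm])
  rw [← hθ, map_sub, sub_eq_zero]
  simp only [monom, Fin.prod_univ_two, hneg, posPart_neg_eq_negPart, negPart_neg_eq_posPart]
  rw [ypow_eq_prod σK 0 _ (Nat.lt_succ_of_le (natDegree_posPart_le (f 0))),
    ypow_eq_prod σK 1 _ (Nat.lt_succ_of_le (natDegree_posPart_le (f 0))),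
    ypow_eq_prod σK 0 _ (Nat.lt_succ_of_le (natDegree_negPart_le (f 0))),
    ypow_eq_prod σK 1 _ (Nat.lt_succ_of_le (natDegree_negPart_le (f 0)))]
  simpa only [map_mul, map_prod, map_pow, coeff_posPart, coeff_negPart] using key

lemma monomial_sub_monomial_mem_latticeIdeal {L : Submodule ℤ[X] (Fin 2 → ℤ[X])}
    {s t : Fin 2 × ℕ →₀ ℕ}
    (h : (fun i => (exponentPoly i s).map (Nat.castRingHom ℤ) -
      (exponentPoly i t).map (Nat.castRingHom ℤ)) ∈ L) :
    MvPolynomial.monomial s 1 - MvPolynomial.monomial t 1 ∈ latticeIdeal σK L := by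
  have hmem : monom σK (fun i => _root_.posPart ((exponentPoly i s).map (Nat.castRingHom ℤ) -
        (exponentPoly i t).map (Nat.castRingHom ℤ))) -
      monom σK (fun i => _root_.negPart ((exponentPoly i s).map (Nat.castRingHom ℤ) -
        (exponentPoly i t).map (Nat.castRingHom ℤ))) ∈ latticeIdeal σK L :=
    subset_sigmaIdealGen _ ⟨_, h, rfl⟩
  have hpos : (fun i => _root_.posPart ((exponentPoly i s).map (Nat.castRingHom ℤ) -
      (exponentPoly i t).map (Nat.castRingHom ℤ))) = fun i => exponentPoly i (s - t) := by
    ext i j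
    simp only [coeff_posPart, coeff_sub, coeff_map, coeff_exponentPoly, Finsupp.tsub_apply]
    simp
  have hneg : (fun i => _root_.negPart ((exponentPoly i s).map (Nat.castRingHom ℤ) -
      (exponentPoly i t).map (Nat.castRingHom ℤ))) = fun i => exponentPoly i (t - s) := by
    ext i j
    simp only [coeff_negPart, coeff_sub, coeff_map, coeff_exponentPoly, Finsupp.tsub_apply]
    simp
  rw [hpos, hneg, monom_exponentPoly, monom_exponentPoly] at hmem
  have hs : s ⊓ t + (s - t) = s := by
    ext v; simp only [Finsupp.add_apply, Finsupp.inf_apply, Finsupp.tsub_apply]; omega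
  have ht : s ⊓ t + (t - s) = t := by
    ext v; simp only [Finsupp.add_apply, Finsupp.inf_apply, Finsupp.tsub_apply]; omega
  have := Ideal.mul_mem_left _ (MvPolynomial.monomial (s ⊓ t) 1) hmem
  rwa [mul_sub, MvPolynomial.monomial_mul, MvPolynomial.monomial_mul, hs, ht, one_mul] at this

lemma sub_mem_span_of_toricDeg_eq {s t : Fin 2 × ℕ →₀ ℕ} (h : toricDeg s = toricDeg t) :
    (fun i => (exponentPoly i s).map (Nat.castRingHom ℤ) -
      (exponentPoly i t).map (Nat.castRingHom ℤ)) ∈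
      Submodule.span ℤ[X] {![(X : ℤ[X]) ^ 2 + 1 - X, (X : ℤ[X]) - X ^ 2 - 1]} := by
  have hcast (q : ℕ[X]) :
      q.map (Nat.castRingHom ℚ) = (q.map (Nat.castRingHom ℤ)).map (Int.castRingHom ℚ) := by
    rw [Polynomial.map_map]
    congr 1
  have hinj : Function.Injective (Int.castRingHom ℚ) := Int.cast_injective
  simp only [toricDeg_apply, Prod.mk.injEq, hcast] at h
  rw [mem_span_lattice_iff]
  constructor
  · have hmonic : (X ^ 2 + 1 - X : ℤ[X]).Monic := by monicity!
    rw [← Polynomial.map_dvd_map _ hinj hmonic]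
    have := h.2
    rw [← sub_eq_zero, ← map_sub, AdjoinRoot.mk_eq_zero] at this
    simpa using this
  · have := h.1
    simp only [← Polynomial.map_add (Int.castRingHom ℚ)] at this
    have := Polynomial.map_injective _ hinj this
    linear_combination this

end LatticeIdeal

/-- For `L = (x²+1−x, x−x²−1) ⊆ ℤ[x]²`, `I_L` is σ-prime and
`I_L = ⟨y_1^{x²+1} y_2^x − y_1^x y_2^{x²+1}, y_1^{x³+1} − y_2^{x³+1}⟩_r`. -/
theorem stmt15 {K : Type*} [Field K] [CharZero K] (σK : K →+* K)
    (L : Submodule (Polynomial ℤ) (Fin 2 → Polynomial ℤ))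
    (hL : L = Submodule.span (Polynomial ℤ)
      {![(Polynomial.X : Polynomial ℤ) ^ 2 + 1 - Polynomial.X,
         (Polynomial.X : Polynomial ℤ) - Polynomial.X ^ 2 - 1]}) :
    IsSigmaPrime (shift σK) (latticeIdeal σK L) ∧
    latticeIdeal σK L = rwmClosure (shift σK)
      {ypow σK 0 (Polynomial.X ^ 2 + 1) * ypow σK 1 Polynomial.X -
        ypow σK 0 Polynomial.X * ypow σK 1 (Polynomial.X ^ 2 + 1),
       ypow σK 0 (Polynomial.X ^ 3 + 1) - ypow σK 1 (Polynomial.X ^ 3 + 1)} := by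
  have hle : latticeIdeal σK L ≤ rwmClosure (shift σK) (latticeGenerators σK) := by
    refine sigmaIdealGen_le ?_ (isSigmaIdeal_rwmClosure _)
    rintro _ ⟨f, hf, rfl⟩
    rw [hL, mem_span_lattice_iff] at hf
    exact mem_rwmClosure_of_forall_prime fun p hp hσ hpG =>
      lattice_binomial_mem_of_prime σK hσ hpG hf.1 hf.2
  have hle_ker : rwmClosure (shift σK) (latticeGenerators σK) ≤ RingHom.ker (toricHom K) :=
    rwmClosure_le_of_isSigmaPrime (latticeGenerators_subset_ker σK) (isSigmaPrime_ker_toricHom σK)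
  have hker_le : RingHom.ker (toricHom K) ≤ latticeIdeal σK L :=
    ker_toricHom_le fun s t hst =>
      monomial_sub_monomial_mem_latticeIdeal σK (hL ▸ sub_mem_span_of_toricDeg_eq hst)
  refine ⟨?_, hle.antisymm (hle_ker.trans hker_le)⟩
  rw [(hle.trans hle_ker).antisymm hker_le]
  exact isSigmaPrime_ker_toricHom σK
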